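/- arXiv:2202.01243 — 2 statements merged into one kernel-verified Lean document; each statement's English description precedes it below -/
import Mathlib

section
/- In the Gaussian linear regression setting with p = D and D > n + 1, let β̂ = X† y be the minimum-norm least squares estimator using all D features, let (x₀, y₀) be a fresh test point with x₀ ∼ N(0, I_D), y₀ = x₀ᵀβ + ε₀, ε₀ ∼ N(0, σ²), independent of the training data, and suppose the released prediction is perturbed by independent Gaussian noise: ŷ₀ = β̂ᵀ x₀ + ε̄ with ε̄ ∼ N(0, σ̄²) independent of everything else. Then the generalization error satisfies exactly E[(y₀ − ŷ₀)²] = 1 + σ² + n·( σ²/(D − n − 1) − 1/D ) + σ̄². -/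
open MeasureTheory ProbabilityTheory Matrix Filter Topology
open scoped NNReal ENNReal

open Classical in
/-- The Moore–Penrose pseudoinverse of a real matrix, characterized by the four
Penrose equations (which determine it uniquely when a solution exists, as it
always does over `ℝ`). -/
noncomputable def pinv {m n : ℕ} (A : Matrix (Fin m) (Fin n) ℝ) : Matrix (Fin n) (Fin m) ℝ :=
  if h : ∃ B : Matrix (Fin n) (Fin m) ℝ,
      A * B * A = A ∧ B * A * B = B ∧ (A * B)ᵀ = A * B ∧ (B * A)ᵀ = B * A
  then h.choose else 0

/-- The law of a vector of `k` i.i.d. standard Gaussian entries. -/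
noncomputable def stdGaussianVec (k : ℕ) : Measure (Fin k → ℝ) :=
  Measure.pi fun _ => gaussianReal 0 1

/-- The law of an `n × D` random matrix with i.i.d. standard Gaussian entries. -/
noncomputable def stdGaussianMatrix (n D : ℕ) : Measure (Fin n → Fin D → ℝ) :=
  Measure.pi fun _ => stdGaussianVec D
/-- The random coefficient vector `β ∼ N(0, (1/D)·I_D)`, modeled as `β = b/√D`
for a standard Gaussian vector `b`. -/
noncomputable def coeffs (D : ℕ) (b : Fin D → ℝ) : Fin D → ℝ := fun j => b j / Real.sqrt D

lemma aux_gauss1 (t : ℝ) (ht : 0 < t) :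
    ∫ x, Real.exp (-t * x ^ 2) ∂(gaussianReal 0 1) = (1 + 2 * t) ^ (-(1/2) : ℝ) := by
  rw [integral_gaussianReal_eq_integral_smul (by simp)]
  have h : ∀ x : ℝ, gaussianPDFReal 0 1 x • Real.exp (-t * x ^ 2)
      = (√(2 * Real.pi))⁻¹ * Real.exp (-(1/2 + t) * x ^ 2) := by
    intro x
    simp only [gaussianPDFReal, smul_eq_mul, NNReal.coe_one, mul_one, sub_zero]
    rw [mul_assoc, ← Real.exp_add]
    ring_nf
  simp_rw [h]
  rw [integral_const_mul, integral_gaussian, Real.rpow_neg (by positivity),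
    ← Real.sqrt_eq_rpow, ← Real.sqrt_inv, ← Real.sqrt_inv, ← Real.sqrt_mul (by positivity)]
  congr 1
  have := Real.pi_pos
  field_simp

lemma aux_gauss2 (k : ℕ) (t : ℝ) (ht : 0 < t) :
    ∫⁻ x : Fin k → ℝ, ENNReal.ofReal (Real.exp (-t * ∑ i, x i ^ 2))
      ∂(Measure.pi fun _ => gaussianReal 0 1)
      = ENNReal.ofReal ((1 + 2 * t) ^ (-(k/2) : ℝ)) := by
  have h : ∀ x : Fin k → ℝ, Real.exp (-t * ∑ i, x i ^ 2) = ∏ i, Real.exp (-t * x i ^ 2) := by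
    intro x
    rw [Finset.mul_sum, Real.exp_sum]
  rw [← ofReal_integral_eq_lintegral_ofReal]
  · simp_rw [h]
    rw [integral_fintype_prod_eq_pow (fun x : ℝ => Real.exp (-t * x ^ 2)), aux_gauss1 t ht,
      ← Real.rpow_mul_natCast (by positivity)]
    congr 2
    simp; ring
  · simp_rw [h]
    apply Integrable.fintype_prod (f := fun _ x => Real.exp (-t * x ^ 2))
    intro i
    apply Integrable.of_bound (C := 1) (by fun_prop)
    filter_upwards with x
    rw [Real.norm_eq_abs, Real.abs_exp, Real.exp_le_one_iff]
    nlinarith [sq_nonneg x, mul_nonneg ht.le (sq_nonneg x)]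
  · filter_upwards with x using (Real.exp_pos _).le

lemma aux_laplace (q : ℝ) (hq : 0 ≤ q) :
    ∫⁻ t in Set.Ioi (0:ℝ), ENNReal.ofReal (Real.exp (-t * q)) = (ENNReal.ofReal q)⁻¹ := by
  rcases hq.eq_or_lt with rfl | hq
  · simp
  · have hi := exp_neg_integrableOn_Ioi 0 hq
    have : ∀ t : ℝ, Real.exp (-t * q) = Real.exp (-q * t) := fun t => by ring_nf
    simp_rw [this]
    rw [← ofReal_integral_eq_lintegral_ofReal hi
      (by filter_upwards with x using (Real.exp_pos _).le),
      integral_exp_mul_Ioi (by linarith), ← ENNReal.ofReal_inv_of_pos hq]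
    congr 1
    simp [neg_div]

lemma aux_tail (k : ℕ) (hk : 3 ≤ k) :
    ∫⁻ t in Set.Ioi (0:ℝ), ENNReal.ofReal ((1 + 2 * t) ^ (-(k/2) : ℝ))
      = ENNReal.ofReal (1 / ((k:ℝ) - 2)) := by
  have hk' : (3:ℝ) ≤ k := by exact_mod_cast hk
  have hd : ∀ x ∈ Set.Ici (0:ℝ), HasDerivAt
      (fun t : ℝ => -(1 / ((k:ℝ) - 2)) * (1 + 2 * t) ^ (1 - k/2 : ℝ)) ((1 + 2 * x) ^ (-(k/2) : ℝ)) x := by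
    intro x hx
    have hx : (0:ℝ) ≤ x := hx
    have h1 : HasDerivAt (fun t : ℝ => 1 + 2 * t) 2 x := by
      simpa using ((hasDerivAt_id x).const_mul 2).const_add 1
    have := (h1.rpow_const (p := (1 - k/2 : ℝ)) (Or.inl (by positivity))).const_mul
      (-(1 / ((k:ℝ) - 2)))
    convert! this using 1
    have e : (1 - (k:ℝ)/2 - 1) = -(k/2) := by ring
    rw [e]
    have : (k:ℝ) - 2 ≠ 0 := by linarith
    field_simp
    ring
  have ht : Tendsto (fun t : ℝ => -(1 / ((k:ℝ) - 2)) * (1 + 2 * t) ^ (1 - k/2 : ℝ)) atTop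
      (𝓝 0) := by
    have h0 : Tendsto (fun t : ℝ => 1 + 2 * t) atTop atTop :=
      tendsto_atTop_add_const_left _ _ (tendsto_id.const_mul_atTop (by norm_num))
    have h1 := (tendsto_rpow_neg_atTop (y := (k/2 - 1 : ℝ)) (by linarith)).comp h0
    have := h1.const_mul (-(1 / ((k:ℝ) - 2)))
    simpa [Function.comp_def] using this
  have hpos : ∀ x ∈ Set.Ioi (0:ℝ), 0 ≤ (1 + 2 * x) ^ (-(k/2) : ℝ) := by
    intro x hx
    have hx : (0:ℝ) < x := hx
    positivity
  have hi := integrableOn_Ioi_deriv_of_nonneg' hd hpos ht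
  rw [← ofReal_integral_eq_lintegral_ofReal hi
      (by filter_upwards [ae_restrict_mem measurableSet_Ioi] with x hx using hpos x hx),
    integral_Ioi_of_hasDerivAt_of_tendsto' hd hi ht]
  simp

/-- Inverse moment of a chi-square variable. -/
lemma aux_chi (k : ℕ) (hk : 3 ≤ k) :
    ∫⁻ x : Fin k → ℝ, (ENNReal.ofReal (∑ i, x i ^ 2))⁻¹
      ∂(Measure.pi fun _ => gaussianReal 0 1)
      = ENNReal.ofReal (1 / ((k:ℝ) - 2)) := by
  have : ∀ x : Fin k → ℝ, (ENNReal.ofReal (∑ i, x i ^ 2))⁻¹ =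
      ∫⁻ t in Set.Ioi (0:ℝ), ENNReal.ofReal (Real.exp (-t * ∑ i, x i ^ 2)) := fun x =>
    (aux_laplace _ (by positivity)).symm
  simp_rw [this]
  rw [lintegral_lintegral_swap (by fun_prop), ← aux_tail k hk]
  apply setLIntegral_congr_fun measurableSet_Ioi
  intro t ht
  exact aux_gauss2 k t ht

lemma aux_proj {D : ℕ} (U : Submodule ℝ (EuclideanSpace ℝ (Fin D))) :
    (stdGaussian (EuclideanSpace ℝ (Fin D))).map U.orthogonalProjectionOnto = stdGaussian U := by
  apply Measure.ext_of_charFun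
  ext t
  rw [charFun_stdGaussian, charFun_apply, integral_map (by fun_prop) (by fun_prop)]
  have : ∀ x : EuclideanSpace ℝ (Fin D), inner ℝ (U.orthogonalProjectionOnto x) t
      = inner ℝ x (t : EuclideanSpace ℝ (Fin D)) := by
    intro x
    simp
  simp_rw [this]
  rw [← charFun_apply, charFun_stdGaussian]
  simp

lemma aux_chi_proj {D : ℕ} (U : Submodule ℝ (EuclideanSpace ℝ (Fin D))) (k : ℕ)
    (hU : Module.finrank ℝ U = k) (hk : 3 ≤ k) :
    ∫⁻ x, (ENNReal.ofReal (‖U.orthogonalProjectionOnto (WithLp.toLp 2 x)‖ ^ 2))⁻¹ ∂(stdGaussianVec D)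
      = ENNReal.ofReal (1 / ((k:ℝ) - 2)) := by
  have h1 : ∫⁻ x, (ENNReal.ofReal (‖U.orthogonalProjectionOnto (WithLp.toLp 2 x)‖ ^ 2))⁻¹
        ∂(stdGaussianVec D)
      = ∫⁻ u : U, (ENNReal.ofReal (‖u‖ ^ 2))⁻¹ ∂(stdGaussian U) := by
    rw [← aux_proj, lintegral_map (by fun_prop) (by fun_prop), ← map_pi_eq_stdGaussian,
      lintegral_map (by fun_prop) (by fun_prop)]
    rfl
  rw [h1, stdGaussian, lintegral_map (by fun_prop) (by fun_prop)]
  subst hU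
  rw [← aux_chi _ hk]
  congr 1
  ext x
  congr 2
  have := (stdOrthonormalBasis ℝ U).sum_sq_norm_inner_right (∑ i, x i • stdOrthonormalBasis ℝ U i)
  rw [← this]
  congr 1
  ext i
  rw [(stdOrthonormalBasis ℝ U).orthonormal.inner_right_fintype, Real.norm_eq_abs, sq_abs]

noncomputable def gramM {n D : ℕ} (X : Fin n → Fin D → ℝ) : Matrix (Fin n) (Fin n) ℝ :=
  Matrix.of X * (Matrix.of X)ᵀ

noncomputable def rinv {n D : ℕ} (X : Fin n → Fin D → ℝ) : Matrix (Fin D) (Fin n) ℝ :=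
  (Matrix.of X)ᵀ * (gramM X)⁻¹

lemma gramM_unit {n D : ℕ} (X : Fin n → Fin D → ℝ) (h : LinearIndependent ℝ X) :
    IsUnit (gramM X).det := by
  have h1 : Function.Injective (Matrix.of X).vecMul := Matrix.vecMul_injective_iff.2 h
  have := (Matrix.PosDef.mul_conjTranspose_self (Matrix.of X) h1).det_pos
  rw [Matrix.conjTranspose_eq_transpose_of_trivial] at this
  exact this.ne'.isUnit

lemma mul_rinv {n D : ℕ} (X : Fin n → Fin D → ℝ) (h : IsUnit (gramM X).det) :
    Matrix.of X * rinv X = 1 := by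
  rw [rinv, ← Matrix.mul_assoc]
  exact Matrix.mul_nonsing_inv _ h

lemma gramM_inv_symm {n D : ℕ} (X : Fin n → Fin D → ℝ) : ((gramM X)⁻¹)ᵀ = (gramM X)⁻¹ := by
  rw [Matrix.transpose_nonsing_inv]
  simp [gramM, Matrix.transpose_mul]

lemma rinv_mul_symm {n D : ℕ} (X : Fin n → Fin D → ℝ) :
    (rinv X * Matrix.of X)ᵀ = rinv X * Matrix.of X := by
  simp only [rinv, Matrix.transpose_mul, gramM_inv_symm, Matrix.transpose_transpose,
    Matrix.mul_assoc]

lemma pinv_eq_rinv {n D : ℕ} (X : Fin n → Fin D → ℝ) (h : IsUnit (gramM X).det) :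
    pinv (Matrix.of X) = rinv X := by
  have hex : ∃ B : Matrix (Fin D) (Fin n) ℝ,
      Matrix.of X * B * Matrix.of X = Matrix.of X ∧ B * Matrix.of X * B = B ∧
      (Matrix.of X * B)ᵀ = Matrix.of X * B ∧ (B * Matrix.of X)ᵀ = B * Matrix.of X := by
    refine ⟨rinv X, ?_, ?_, ?_, rinv_mul_symm X⟩
    · rw [mul_rinv X h, Matrix.one_mul]
    · rw [Matrix.mul_assoc, mul_rinv X h, Matrix.mul_one]
    · rw [mul_rinv X h, Matrix.transpose_one]
  rw [pinv, dif_pos hex]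
  obtain ⟨h1, h2, h3, h4⟩ := hex.choose_spec
  generalize hex.choose = B at *
  have hAB : Matrix.of X * B = 1 := by
    have := congrArg (· * rinv X) h1
    simpa only [Matrix.mul_assoc, mul_rinv X h, Matrix.mul_one] using this
  have hB : B = (Matrix.of X)ᵀ * (Bᵀ * B) := by
    rw [← Matrix.mul_assoc, ← Matrix.transpose_mul, h4, h2]
  have hG : gramM X * (Bᵀ * B) = 1 := by
    rw [gramM, Matrix.mul_assoc, ← hB, hAB]
  rw [rinv, Matrix.inv_eq_right_inv hG]
  exact hB

lemma rinv_sq {n D : ℕ} (X : Fin n → Fin D → ℝ) (h : IsUnit (gramM X).det) :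
    (rinv X)ᵀ * rinv X = (gramM X)⁻¹ := by
  rw [rinv, Matrix.transpose_mul, Matrix.transpose_transpose, gramM_inv_symm, Matrix.mul_assoc,
    ← Matrix.mul_assoc (Matrix.of X)]
  change (gramM X)⁻¹ * (gramM X * (gramM X)⁻¹) = _
  rw [Matrix.mul_nonsing_inv _ h, Matrix.mul_one]

lemma sum_rinv_sq {n D : ℕ} (X : Fin n → Fin D → ℝ) (h : IsUnit (gramM X).det) (i : Fin n) :
    ∑ j, (rinv X j i) ^ 2 = (gramM X)⁻¹ i i := by
  rw [← rinv_sq X h, Matrix.mul_apply]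
  simp [pow_two]

lemma sum_resid_sq {n D : ℕ} (X : Fin n → Fin D → ℝ) (h : IsUnit (gramM X).det) :
    ∑ j, ∑ k, ((1 - rinv X * Matrix.of X : Matrix (Fin D) (Fin D) ℝ) j k) ^ 2 = (D : ℝ) - n := by
  set Q := (1 - rinv X * Matrix.of X : Matrix (Fin D) (Fin D) ℝ) with hQ
  have hs : Qᵀ = Q := by rw [hQ, Matrix.transpose_sub, rinv_mul_symm, Matrix.transpose_one]
  have hi : Q * Q = Q := by
    have : rinv X * Matrix.of X * (rinv X * Matrix.of X) = rinv X * Matrix.of X := by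
      rw [Matrix.mul_assoc, ← Matrix.mul_assoc (Matrix.of X), mul_rinv X h, Matrix.one_mul]
    rw [hQ, Matrix.sub_mul, Matrix.mul_sub, Matrix.mul_sub, this]
    simp
  have : ∑ j, ∑ k, (Q j k) ^ 2 = (Q * Qᵀ).trace := by
    simp [Matrix.trace, Matrix.mul_apply, pow_two]
  rw [this, hs, hi, hQ, Matrix.trace_sub, Matrix.trace_mul_comm, mul_rinv X h]
  simp

def othersSpan {m D : ℕ} (Y : Fin m → Fin D → ℝ) : Submodule ℝ (EuclideanSpace ℝ (Fin D)) :=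
  Submodule.span ℝ (Set.range fun j => (WithLp.toLp 2 (Y j) : EuclideanSpace ℝ (Fin D)))

lemma gramM_inv_diag {m D : ℕ} (X : Fin (m+1) → Fin D → ℝ) (h : IsUnit (gramM X).det)
    (i : Fin (m+1)) :
    (gramM X)⁻¹ i i = (‖(othersSpan (fun j => X (i.succAbove j)))ᗮ.orthogonalProjectionOnto
      (WithLp.toLp 2 (X i))‖ ^ 2)⁻¹ := by
  set U := othersSpan (fun j => X (i.succAbove j)) with hU
  set c := (gramM X)⁻¹ i i with hc
  set w : EuclideanSpace ℝ (Fin D) := WithLp.toLp 2 (fun j => rinv X j i) with hw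
  have hXw : ∀ k, inner ℝ (WithLp.toLp 2 (X k) : EuclideanSpace ℝ (Fin D)) w = if k = i then 1 else 0 := by
    intro k
    have := congrFun (congrFun (mul_rinv X h) k) i
    rw [Matrix.mul_apply, Matrix.one_apply] at this
    rw [← this, hw, PiLp.inner_apply]
    simp [mul_comm]
  have hwn : ‖w‖ ^ 2 = c := by
    rw [EuclideanSpace.real_norm_sq_eq, hc, ← sum_rinv_sq X h]
  have hwU : w ∈ Uᗮ := by
    rw [Submodule.mem_orthogonal]
    intro u hu
    induction hu using Submodule.span_induction with
    | mem x hx =>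
      obtain ⟨j, rfl⟩ := hx
      simp [hXw, Fin.succAbove_ne]
    | zero => simp
    | add x y _ _ hx hy => rw [inner_add_left, hx, hy, add_zero]
    | smul a x _ hx => rw [inner_smul_left, hx, mul_zero]
  have hdec : w = c • (WithLp.toLp 2 (X i) : EuclideanSpace ℝ (Fin D)) +
      ∑ j, (gramM X)⁻¹ (i.succAbove j) i • (WithLp.toLp 2 (X (i.succAbove j)) : EuclideanSpace ℝ (Fin D)) := by
    rw [hc, ← Fin.sum_univ_succAbove (fun k => (gramM X)⁻¹ k i • (WithLp.toLp 2 (X k) : EuclideanSpace ℝ (Fin D))) i]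
    ext j
    simp [hw, rinv, Matrix.mul_apply, mul_comm]
  have hrest : ∑ j, (gramM X)⁻¹ (i.succAbove j) i • (WithLp.toLp 2 (X (i.succAbove j)) : EuclideanSpace ℝ (Fin D)) ∈ U :=
    Submodule.sum_mem _ fun j _ => Submodule.smul_mem _ _ (Submodule.subset_span ⟨j, rfl⟩)
  have hP : Uᗮ.orthogonalProjectionOnto w = c • Uᗮ.orthogonalProjectionOnto (WithLp.toLp 2 (X i)) := by
    rw [hdec, map_add, map_smul]
    rw [Submodule.orthogonalProjectionOnto_orthogonal_apply_eq_zero hrest, add_zero]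
  have hPw : ‖Uᗮ.orthogonalProjectionOnto w‖ = ‖w‖ := by
    exact Submodule.norm_orthogonalProjectionOnto_apply _ hwU
  have hc0 : c ≠ 0 := by
    intro h0
    rw [h0] at hwn
    have : w = 0 := by simpa using hwn
    have := hXw i
    simp [‹w = 0›] at this
  have key : c = c ^ 2 * ‖Uᗮ.orthogonalProjectionOnto (WithLp.toLp 2 (X i))‖ ^ 2 := by
    rw [← mul_pow, ← sq_abs (c * _), abs_mul, abs_norm, ← Real.norm_eq_abs c, ← norm_smul, ← hP,
      hPw, hwn]
  have : c * ‖Uᗮ.orthogonalProjectionOnto (WithLp.toLp 2 (X i))‖ ^ 2 = 1 := by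
    apply mul_left_cancel₀ hc0
    linarith
  exact eq_inv_of_mul_eq_one_left this

instance stdGaussianVec_prob (k : ℕ) : IsProbabilityMeasure (stdGaussianVec k) := by
  unfold stdGaussianVec; infer_instance

instance stdGaussianMatrix_prob (n D : ℕ) : IsProbabilityMeasure (stdGaussianMatrix n D) := by
  unfold stdGaussianMatrix; infer_instance

lemma continuous_gramM (n D : ℕ) : Continuous (fun X : Fin n → Fin D → ℝ => gramM X) := by
  unfold gramM
  apply Continuous.matrix_mul
  · exact continuous_id
  · exact Continuous.matrix_transpose continuous_id

lemma measurable_det (n D : ℕ) : Measurable (fun X : Fin n → Fin D → ℝ => (gramM X).det) :=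
  (continuous_gramM n D).matrix_det.measurable

lemma measurable_inv_entry (n D : ℕ) (i j : Fin n) :
    Measurable (fun X : Fin n → Fin D → ℝ => (gramM X)⁻¹ i j) := by
  simp only [Matrix.inv_def, Ring.inverse_eq_inv', Matrix.smul_apply, smul_eq_mul]
  exact (measurable_det n D).inv.mul
    ((continuous_gramM n D).matrix_adjugate.matrix_elem i j).measurable

lemma measurable_rinv_entry (n D : ℕ) (i : Fin D) (j : Fin n) :
    Measurable (fun X : Fin n → Fin D → ℝ => rinv X i j) := by
  simp only [rinv, Matrix.mul_apply, Matrix.transpose_apply, Matrix.of_apply]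
  apply Finset.measurable_sum
  intro k _
  exact Measurable.mul (by fun_prop) (measurable_inv_entry n D k j)

lemma finrank_others {m D : ℕ} (Y : Fin m → Fin D → ℝ) (h : LinearIndependent ℝ Y) :
    Module.finrank ℝ (othersSpan Y)ᗮ = D - m := by
  have h1 : LinearIndependent ℝ (fun j => (WithLp.toLp 2 (Y j) : EuclideanSpace ℝ (Fin D))) :=
    h.map' (WithLp.linearEquiv 2 ℝ (Fin D → ℝ)).symm.toLinearMap (LinearEquiv.ker _)
  have h2 : Module.finrank ℝ (othersSpan Y) = m := by
    rw [othersSpan, finrank_span_eq_card h1]; simp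
  have := (othersSpan Y).finrank_add_finrank_orthogonal
  rw [h2] at this
  simp at this
  omega

lemma mem_others {m D : ℕ} (Y : Fin m → Fin D → ℝ) (x : Fin D → ℝ)
    (h : x ∈ Submodule.span ℝ (Set.range Y)) : WithLp.toLp 2 x ∈ othersSpan Y := by
  have := Submodule.mem_map_of_mem (f := (WithLp.linearEquiv 2 ℝ (Fin D → ℝ)).symm.toLinearMap) h
  rw [Submodule.map_span, ← Set.range_comp] at this
  exact this

lemma indep_of_det {n D : ℕ} (Y : Fin n → Fin D → ℝ) (hY : (gramM Y).det ≠ 0) :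
    LinearIndependent ℝ Y := by
  have hinj : Function.Injective (Matrix.of Y).vecMul := by
    intro a b hab
    have : Matrix.vecMul a (gramM Y) = Matrix.vecMul b (gramM Y) := by
      rw [gramM, ← Matrix.vecMul_vecMul, ← Matrix.vecMul_vecMul]
      exact congrArg (fun z => Matrix.vecMul z (Matrix.of Y)ᵀ) hab
    have h3 := congrArg (fun z => Matrix.vecMul z (gramM Y)⁻¹) this
    simpa [Matrix.vecMul_vecMul, Matrix.mul_nonsing_inv _ hY.isUnit] using h3
  exact Matrix.vecMul_injective_iff.1 hinj

lemma ae_indep (D n : ℕ) (hn : n + 1 < D) :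
    ∀ᵐ X ∂(stdGaussianMatrix n D), (gramM X).det ≠ 0 := by
  induction n with
  | zero =>
    filter_upwards with X
    simp
  | succ n ih =>
    have ih := ih (by omega)
    have mp := measurePreserving_piFinSuccAbove (fun _ : Fin (n+1) => stdGaussianVec D) 0
    set e := (MeasurableEquiv.piFinSuccAbove (fun _ : Fin (n+1) => (Fin D → ℝ)) 0)
    have hm : MeasurableSet {p : (Fin D → ℝ) × (Fin n → Fin D → ℝ) | (gramM (e.symm (p.1, p.2))).det ≠ 0} :=
      (((measurable_det _ _).comp e.symm.measurable) (measurableSet_singleton (0:ℝ))).compl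
    have hmain : ∀ᵐ p ∂((stdGaussianVec D).prod (stdGaussianMatrix n D)),
        (gramM (e.symm (p.1, p.2))).det ≠ 0 := by
      rw [Measure.ae_prod_iff_ae_ae hm]
      rw [Measure.ae_ae_comm (p := fun x Y => (gramM (e.symm (x, Y))).det ≠ 0) hm]
      filter_upwards [ih] with Y hY
      have hLI : LinearIndependent ℝ Y := by
        exact indep_of_det Y hY
      have hchi := aux_chi_proj (othersSpan Y)ᗮ (D - n) (finrank_others Y hLI) (by omega)
      have hfin := ae_lt_top' (μ := stdGaussianVec D)
        (f := fun x => (ENNReal.ofReal (‖(othersSpan Y)ᗮ.orthogonalProjectionOnto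
          (WithLp.toLp 2 x)‖ ^ 2))⁻¹) (by fun_prop) (by rw [hchi]; simp)
      filter_upwards [hfin] with x hx
      apply (gramM_unit _ _).ne_zero
      have : e.symm (x, Y) = Fin.cons x Y := by
        exact Fin.insertNth_zero' (β := Fin D → ℝ) x Y
      rw [this, linearIndependent_finCons]
      refine ⟨hLI, fun hmem => ?_⟩
      rw [Submodule.orthogonalProjectionOnto_orthogonal_apply_eq_zero (mem_others Y x hmem)] at hx
      simp at hx
    have := mp.quasiMeasurePreserving.ae hmain
    filter_upwards [this] with X hX
    simpa using hX

lemma expect_inv (m D : ℕ) (hn : m + 1 + 1 < D) (i : Fin (m+1)) :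
    ∫⁻ X, ENNReal.ofReal ((gramM X)⁻¹ i i) ∂(stdGaussianMatrix (m+1) D)
      = ENNReal.ofReal (1 / ((D:ℝ) - ((m+1 : ℕ) : ℝ) - 1)) := by
  have mp := measurePreserving_piFinSuccAbove (fun _ : Fin (m+1) => stdGaussianVec D) i
  set e := (MeasurableEquiv.piFinSuccAbove (fun _ : Fin (m+1) => (Fin D → ℝ)) i)
  have hm : MeasurableSet {p : (Fin D → ℝ) × (Fin m → Fin D → ℝ) | (gramM (e.symm (p.1, p.2))).det ≠ 0} :=
      (((measurable_det _ _).comp e.symm.measurable) (measurableSet_singleton (0:ℝ))).compl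
  have hdet : ∀ᵐ p ∂((stdGaussianVec D).prod (stdGaussianMatrix m D)),
        (gramM (e.symm (p.1, p.2))).det ≠ 0 :=
    (MeasurePreserving.symm e mp).quasiMeasurePreserving.ae (ae_indep D (m+1) hn)
  have hLI0 : ∀ᵐ Y ∂(stdGaussianMatrix m D), (gramM Y).det ≠ 0 := ae_indep D m (by omega)
  rw [Measure.ae_prod_iff_ae_ae hm,
    Measure.ae_ae_comm (p := fun x Y => (gramM (e.symm (x, Y))).det ≠ 0) hm] at hdet
  have h1 : ∫⁻ X, ENNReal.ofReal ((gramM X)⁻¹ i i) ∂(stdGaussianMatrix (m+1) D)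
      = ∫⁻ p, ENNReal.ofReal ((gramM (e.symm p))⁻¹ i i)
        ∂((stdGaussianVec D).prod (stdGaussianMatrix m D)) :=
    ((MeasurePreserving.symm e mp).lintegral_comp_emb e.symm.measurableEmbedding _).symm
  have hme : Measurable (fun p => ENNReal.ofReal ((gramM (e.symm p))⁻¹ i i)) :=
    ((measurable_inv_entry (m+1) D i i).comp e.symm.measurable).ennreal_ofReal
  rw [h1, lintegral_prod_symm' _ hme]
  have h2 : ∀ᵐ Y ∂(stdGaussianMatrix m D), ∫⁻ x, ENNReal.ofReal ((gramM (e.symm (x, Y)))⁻¹ i i)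
      ∂(stdGaussianVec D) = ENNReal.ofReal (1 / ((D:ℝ) - ((m+1 : ℕ) : ℝ) - 1)) := by
    filter_upwards [hdet, hLI0] with Y hY hY0
    have hchi := aux_chi_proj (othersSpan Y)ᗮ (D - m) (finrank_others Y (indep_of_det Y hY0)) (by omega)
    have hcast : (((D - m : ℕ) : ℝ) - 2) = ((D:ℝ) - ((m+1 : ℕ) : ℝ) - 1) := by
      rw [Nat.cast_sub (by omega)]; push_cast; ring
    rw [hcast] at hchi
    rw [← hchi]
    have hfin := ae_lt_top' (μ := stdGaussianVec D)
        (f := fun x => (ENNReal.ofReal (‖(othersSpan Y)ᗮ.orthogonalProjectionOnto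
          (WithLp.toLp 2 x)‖ ^ 2))⁻¹) (by fun_prop) (by rw [hchi]; simp)
    apply lintegral_congr_ae
    filter_upwards [hY, hfin] with x hx hx2
    have h3 := gramM_inv_diag (e.symm (x, Y)) hx.isUnit i
    have e1 : (e.symm (x, Y)) i = x := Fin.insertNth_apply_same (α := fun _ => Fin D → ℝ) i x Y
    have e2 : (fun j => e.symm (x, Y) (i.succAbove j)) = Y := by
      ext1 j
      exact Fin.insertNth_apply_succAbove (α := fun _ => Fin D → ℝ) i x Y j
    rw [e1, e2] at h3
    rw [h3, ENNReal.ofReal_inv_of_pos]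
    by_contra hcon
    rw [ENNReal.ofReal_eq_zero.2 (not_lt.1 hcon)] at hx2
    simp at hx2
  rw [lintegral_congr_ae h2]
  simp

lemma mom_scalar (K c a : ℝ) (hK : 0 ≤ K) :
    ∫⁻ z, ENNReal.ofReal (K + (c + a * z) ^ 2) ∂(gaussianReal 0 1)
      = ENNReal.ofReal (K + (c ^ 2 + a ^ 2)) := by
  have hid : MemLp (fun z : ℝ => z) 2 (gaussianReal 0 1) := memLp_id_gaussianReal' 2 (by simp)
  have hY : MemLp (fun z : ℝ => c + a * z) 2 (gaussianReal 0 1) :=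
    (memLp_const c).add (hid.const_mul a)
  have hi1 : Integrable (fun z : ℝ => z) (gaussianReal 0 1) := hid.integrable (by norm_num)
  have hv : ∫ z, z ^ 2 ∂(gaussianReal 0 1) = 1 := by
    have h1 := variance_eq_sub (X := (id : ℝ → ℝ)) (memLp_id_gaussianReal' (μ := 0) (v := 1) 2 (by simp))
    rw [variance_id_gaussianReal] at h1
    simpa using h1.symm
  have hKi : Integrable (fun z : ℝ => K + (c + a * z) ^ 2) (gaussianReal 0 1) :=
    (integrable_const K).add hY.integrable_sq
  rw [← ofReal_integral_eq_lintegral_ofReal hKi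
    (by filter_upwards with z; positivity)]
  congr 1
  have : ∀ z : ℝ, K + (c + a * z) ^ 2 = (K + c ^ 2) + (2 * c * a * z + a ^ 2 * z ^ 2) := by
    intro z; ring
  simp_rw [this]
  have i1 : Integrable (fun z : ℝ => 2 * c * a * z) (gaussianReal 0 1) := hi1.const_mul _
  have i2 : Integrable (fun z : ℝ => a ^ 2 * z ^ 2) (gaussianReal 0 1) :=
    hid.integrable_sq.const_mul _
  have i3 : Integrable (fun z : ℝ => 2 * c * a * z + a ^ 2 * z ^ 2) (gaussianReal 0 1) := i1.add i2
  rw [integral_add (integrable_const _) i3, integral_add i1 i2, integral_const_mul,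
    integral_const_mul, hv, integral_id_gaussianReal]
  simp
  ring

lemma mom_lin (k : ℕ) (c : ℝ) (a : Fin k → ℝ) :
    Integrable (fun z : Fin k → ℝ => (c + ∑ i, a i * z i) ^ 2) (stdGaussianVec k) ∧
    ∫ z, (c + ∑ i, a i * z i) ^ 2 ∂(stdGaussianVec k) = c ^ 2 + ∑ i, a i ^ 2 := by
  have hid : ∀ i, MemLp (fun z : ℝ => a i * z) 2 (gaussianReal 0 1) := fun i =>
    (memLp_id_gaussianReal' 2 (by simp)).const_mul (a i)
  have hev : ∀ i, MemLp (fun z : Fin k → ℝ => a i * z i) 2 (stdGaussianVec k) := fun i =>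
    (hid i).comp_measurePreserving (measurePreserving_eval (fun _ : Fin k => gaussianReal 0 1) i)
  have hS : MemLp (fun z : Fin k → ℝ => ∑ i, a i * z i) 2 (stdGaussianVec k) :=
    memLp_finsetSum _ fun i _ => hev i
  have hY : MemLp (fun z : Fin k → ℝ => c + ∑ i, a i * z i) 2 (stdGaussianVec k) :=
    (memLp_const c).add hS
  refine ⟨hY.integrable_sq, ?_⟩
  have hmean : ∫ z, (∑ i, a i * z i) ∂(stdGaussianVec k) = 0 := by
    rw [integral_finsetSum _ fun i _ => (hev i).integrable (by norm_num)]
    apply Finset.sum_eq_zero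
    intro i _
    rw [integral_const_mul]
    have := integral_comp_eval (μ := fun _ : Fin k => gaussianReal 0 1) (i := i)
      (f := fun z : ℝ => z) (by fun_prop)
    rw [stdGaussianVec, this, integral_id_gaussianReal, mul_zero]
  have hvar : Var[fun z : Fin k → ℝ => ∑ i, a i * z i; stdGaussianVec k] = ∑ i, a i ^ 2 := by
    have := variance_sum_pi (μ := fun _ : Fin k => gaussianReal 0 1) (X := fun i z => a i * z) hid
    have e : (∑ i, fun z : Fin k → ℝ => a i * z i) = fun z : Fin k → ℝ => ∑ i, a i * z i := by
      ext z; simp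
    rw [e] at this
    rw [stdGaussianVec, this]
    apply Finset.sum_congr rfl
    intro i _
    change Var[fun x => _ * (id x); gaussianReal 0 1] = _
    rw [variance_const_mul, variance_id_gaussianReal]
    simp
  have hsq : ∫ z, (∑ i, a i * z i) ^ 2 ∂(stdGaussianVec k) = ∑ i, a i ^ 2 := by
    have h1 := variance_eq_sub hS
    rw [hvar, hmean] at h1
    simpa using h1.symm
  have : ∀ z : Fin k → ℝ, (c + ∑ i, a i * z i) ^ 2
      = c ^ 2 + (2 * c * (∑ i, a i * z i) + (∑ i, a i * z i) ^ 2) := by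
    intro z; ring
  simp_rw [this]
  have i1 := (hS.integrable (by norm_num)).const_mul (2 * c)
  have i3 : Integrable (fun z : Fin k → ℝ => 2 * c * (∑ i, a i * z i) + (∑ i, a i * z i) ^ 2)
    (stdGaussianVec k) := i1.add hS.integrable_sq
  rw [integral_add (integrable_const _) i3,
    integral_add i1 hS.integrable_sq, integral_const_mul, hmean, hsq]
  simp

lemma mom_vec (k l : ℕ) (K : ℝ) (hK : 0 ≤ K) (c : Fin l → ℝ) (a : Fin l → Fin k → ℝ) :
    ∫⁻ z, ENNReal.ofReal (K + ∑ j, (c j + ∑ i, a j i * z i) ^ 2) ∂(stdGaussianVec k)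
      = ENNReal.ofReal (K + ∑ j, (c j ^ 2 + ∑ i, a j i ^ 2)) := by
  have hi : Integrable (fun z : Fin k → ℝ => ∑ j, (c j + ∑ i, a j i * z i) ^ 2)
      (stdGaussianVec k) := integrable_finsetSum _ fun j _ => (mom_lin k (c j) (a j)).1
  have hKi : Integrable (fun z : Fin k → ℝ => K + ∑ j, (c j + ∑ i, a j i * z i) ^ 2)
      (stdGaussianVec k) := (integrable_const K).add hi
  rw [← ofReal_integral_eq_lintegral_ofReal hKi
    (by filter_upwards with z; positivity), integral_add (integrable_const K) hi,
    integral_finsetSum _ fun j _ => (mom_lin k (c j) (a j)).1]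
  simp [(mom_lin k _ _).2]

lemma expect_trace (n D : ℕ) (hn : n + 1 < D) (K s : ℝ) (hK : 0 ≤ K) (hs : 0 ≤ s) :
    ∫⁻ X, ENNReal.ofReal (K + s * ∑ i, ∑ j, (rinv X j i) ^ 2) ∂(stdGaussianMatrix n D)
      = ENNReal.ofReal (K + s * (n * (1 / ((D:ℝ) - n - 1)))) := by
  have hD : (0:ℝ) < (D:ℝ) - n - 1 := by
    have : ((n + 1 : ℕ) : ℝ) < D := by exact_mod_cast hn
    push_cast at this; linarith
  have h1 : ∀ᵐ X ∂(stdGaussianMatrix n D),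
      ENNReal.ofReal (K + s * ∑ i, ∑ j, (rinv X j i) ^ 2)
       = ENNReal.ofReal K + ENNReal.ofReal s * ∑ i, ENNReal.ofReal ((gramM X)⁻¹ i i) := by
    filter_upwards [ae_indep D n hn] with X hX
    rw [ENNReal.ofReal_add hK (by positivity), ENNReal.ofReal_mul hs,
      ENNReal.ofReal_sum_of_nonneg fun i _ => by positivity]
    simp_rw [sum_rinv_sq X hX.isUnit]
  rw [lintegral_congr_ae h1]
  have hm : ∀ i, Measurable (fun X : Fin n → Fin D → ℝ => ENNReal.ofReal ((gramM X)⁻¹ i i)) :=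
    fun i => (measurable_inv_entry n D i i).ennreal_ofReal
  rw [lintegral_add_left (by fun_prop), lintegral_const_mul _ (by fun_prop),
    lintegral_finsetSum _ (fun i _ => hm i)]
  have h2 : ∀ i : Fin n, ∫⁻ X, ENNReal.ofReal ((gramM X)⁻¹ i i) ∂(stdGaussianMatrix n D)
      = ENNReal.ofReal (1 / ((D:ℝ) - n - 1)) := by
    intro i
    cases n with
    | zero => exact i.elim0
    | succ m => exact expect_inv m D hn i
  simp_rw [h2]
  rw [ENNReal.ofReal_add hK (by positivity), ENNReal.ofReal_mul hs,
    ENNReal.ofReal_mul (by positivity)]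
  simp

/-- **Generalization error of min-norm least squares with output noise addition.**
In the Gaussian data setting with `p = D > n + 1`, if the released prediction is
`ŷ₀ = β̂ᵀx₀ + ε̄` with `β̂ = X†y` and independent noise `ε̄ ∼ N(0, σ̄²)`, then
`E[(y₀ − ŷ₀)²] = 1 + σ² + n(σ²/(D − n − 1) − 1/D) + σ̄²`.
The sample space is `(X entries, b, e, x₀, e₀, ē)` with all coordinates i.i.d.
standard Gaussian; `β = b/√D`, training noise `ε = σe`, test noise `ε₀ = σe₀`,
released noise `ε̄ = σ̄ē`, `yᵢ = xᵢᵀβ + εᵢ` and `y₀ = x₀ᵀβ + ε₀`. -/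
theorem generalization_error_noise_addition (n D : ℕ) (hnD : n + 1 < D)
    (σ σbar : ℝ) (hσ : 0 < σ) (hσbar : 0 ≤ σbar) :
    ∫ ω : (Fin n → Fin D → ℝ) × (Fin D → ℝ) × (Fin n → ℝ) × (Fin D → ℝ) × ℝ × ℝ,
      (((∑ j, ω.2.2.2.1 j * coeffs D ω.2.1 j) + σ * ω.2.2.2.2.1) -
        ((∑ j, ω.2.2.2.1 j *
          (pinv (Matrix.of ω.1) *ᵥ
            (fun i => (∑ jd, ω.1 i jd * coeffs D ω.2.1 jd) + σ * ω.2.2.1 i)) j)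
          + σbar * ω.2.2.2.2.2)) ^ 2
      ∂((stdGaussianMatrix n D).prod ((stdGaussianVec D).prod ((stdGaussianVec n).prod
          ((stdGaussianVec D).prod ((gaussianReal 0 1).prod (gaussianReal 0 1))))))
    = 1 + σ ^ 2 + n * (σ ^ 2 / ((D : ℝ) - n - 1) - 1 / (D : ℝ)) + σbar ^ 2 := by
  have hDpos : (0:ℝ) < D := by
    have : 0 < D := by omega
    exact_mod_cast this
  have hnD' : (0:ℝ) < (D:ℝ) - n - 1 := by
    have : ((n + 1 : ℕ) : ℝ) < D := by exact_mod_cast hnD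
    push_cast at this; linarith
  set F : (Fin n → Fin D → ℝ) × (Fin D → ℝ) × (Fin n → ℝ) × (Fin D → ℝ) × ℝ × ℝ → ℝ := fun ω =>
      (((∑ j, ω.2.2.2.1 j * coeffs D ω.2.1 j) + σ * ω.2.2.2.2.1) -
        ((∑ j, ω.2.2.2.1 j *
          (∑ i, rinv ω.1 j i *
            ((∑ jd, ω.1 i jd * coeffs D ω.2.1 jd) + σ * ω.2.2.1 i)))
          + σbar * ω.2.2.2.2.2)) ^ 2 with hF
  have hr : ∀ (j : Fin D) (i : Fin n), Measurable
      (fun ω : (Fin n → Fin D → ℝ) × (Fin D → ℝ) × (Fin n → ℝ) × (Fin D → ℝ) × ℝ × ℝ =>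
        rinv ω.1 j i) := fun j i => (measurable_rinv_entry n D j i).comp measurable_fst
  have hFm : Measurable F := by
    simp only [hF, coeffs]
    fun_prop
  have hae : ∀ᵐ ω ∂((stdGaussianMatrix n D).prod ((stdGaussianVec D).prod ((stdGaussianVec n).prod
          ((stdGaussianVec D).prod ((gaussianReal 0 1).prod (gaussianReal 0 1)))))),
      (((∑ j, ω.2.2.2.1 j * coeffs D ω.2.1 j) + σ * ω.2.2.2.2.1) -
        ((∑ j, ω.2.2.2.1 j *
          (pinv (Matrix.of ω.1) *ᵥ
            (fun i => (∑ jd, ω.1 i jd * coeffs D ω.2.1 jd) + σ * ω.2.2.1 i)) j)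
          + σbar * ω.2.2.2.2.2)) ^ 2 = F ω := by
    filter_upwards [Measure.quasiMeasurePreserving_fst.ae (ae_indep D n hnD)] with ω hω
    rw [pinv_eq_rinv ω.1 hω.isUnit]
    rfl
  rw [integral_congr_ae hae, integral_eq_lintegral_of_nonneg_ae
    (by filter_upwards with ω; simp only [hF]; positivity) hFm.aestronglyMeasurable]
  rw [lintegral_prod _ (by fun_prop)]
  have hX : ∀ᵐ X ∂(stdGaussianMatrix n D),
      ∫⁻ q, ENNReal.ofReal (F (X, q)) ∂((stdGaussianVec D).prod ((stdGaussianVec n).prod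
          ((stdGaussianVec D).prod ((gaussianReal 0 1).prod (gaussianReal 0 1)))))
      = ENNReal.ofReal ((σ ^ 2 + σbar ^ 2 + ((D:ℝ) - n) / D)
          + σ ^ 2 * ∑ i, ∑ j, (rinv X j i) ^ 2) := by
    filter_upwards [ae_indep D n hnD] with X hdet
    set Q := (1 - rinv X * Matrix.of X : Matrix (Fin D) (Fin D) ℝ) with hQ
    -- the residual vector
    have hres : ∀ (b : Fin D → ℝ) (e : Fin n → ℝ) (j : Fin D),
        coeffs D b j - ∑ i, rinv X j i * ((∑ jd, X i jd * coeffs D b jd) + σ * e i)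
        = (∑ k, (Q j k / √D) * b k) + ∑ i, (-σ * rinv X j i) * e i := by
      intro b e j
      have h1 : ∑ k, (Q j k / √D) * b k = (Q *ᵥ coeffs D b) j := by
        simp only [Matrix.mulVec, dotProduct, coeffs]
        apply Finset.sum_congr rfl; intro k _; ring
      have h2 : (Q *ᵥ coeffs D b) j = coeffs D b j - ∑ i, rinv X j i * ∑ jd, X i jd * coeffs D b jd := by
        rw [hQ, Matrix.sub_mulVec, Matrix.one_mulVec, ← Matrix.mulVec_mulVec]
        rfl
      rw [h1, h2]
      simp only [mul_add, Finset.sum_add_distrib]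
      have : ∑ i, rinv X j i * (σ * e i) = - ∑ i, (-σ * rinv X j i) * e i := by
        rw [← Finset.sum_neg_distrib]
        apply Finset.sum_congr rfl; intro k _; ring
      rw [this]; ring
    have hFX : ∀ b e x0 e0 eb, F (X, b, e, x0, e0, eb) = 0 + ((∑ j, ((∑ k, (Q j k / √D) * b k) + ∑ i, (-σ * rinv X j i) * e i) * x0 j + σ * e0) + (-σbar) * eb) ^ 2 := by
      intro b e x0 e0 eb
      simp_rw [← hres, hF]
      simp only [sub_mul, Finset.sum_sub_distrib]
      simp only [mul_comm (x0 _)]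
      ring
    have m1 : Measurable fun q => ENNReal.ofReal (F (X, q)) := by fun_prop
    rw [lintegral_prod _ m1.aemeasurable]
    have s1 : ∀ b, ∫⁻ q, ENNReal.ofReal (F (X, b, q)) ∂((stdGaussianVec n).prod
          ((stdGaussianVec D).prod ((gaussianReal 0 1).prod (gaussianReal 0 1))))
        = ENNReal.ofReal ((σ ^ 2 + σbar ^ 2 + σ ^ 2 * ∑ i, ∑ j, (rinv X j i) ^ 2) +
            ∑ j, (0 + ∑ k, (Q j k / √D) * b k) ^ 2) := by
      intro b
      have m2 : Measurable fun q => ENNReal.ofReal (F (X, b, q)) := by fun_prop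
      rw [lintegral_prod _ m2.aemeasurable]
      have s2 : ∀ e, ∫⁻ q, ENNReal.ofReal (F (X, b, e, q)) ∂((stdGaussianVec D).prod
            ((gaussianReal 0 1).prod (gaussianReal 0 1)))
          = ENNReal.ofReal ((σ ^ 2 + σbar ^ 2) +
            ∑ j, ((∑ k, (Q j k / √D) * b k) + ∑ i, (-σ * rinv X j i) * e i) ^ 2) := by
        intro e
        have m3 : Measurable fun q => ENNReal.ofReal (F (X, b, e, q)) := by fun_prop
        rw [lintegral_prod _ m3.aemeasurable]
        set u : Fin D → ℝ := fun j => (∑ k, (Q j k / √D) * b k) + ∑ i, (-σ * rinv X j i) * e i with hu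
        have s3 : ∀ x0, ∫⁻ q, ENNReal.ofReal (F (X, b, e, x0, q))
            ∂((gaussianReal 0 1).prod (gaussianReal 0 1))
            = ENNReal.ofReal ((σ ^ 2 + σbar ^ 2) + ∑ _l : Fin 1, (0 + ∑ j, u j * x0 j) ^ 2) := by
          intro x0
          have m4 : Measurable fun q => ENNReal.ofReal (F (X, b, e, x0, q)) := by fun_prop
          rw [lintegral_prod _ m4.aemeasurable]
          simp_rw [hFX, mom_scalar _ _ _ le_rfl]
          have : ∀ e0 : ℝ, 0 + ((∑ j, ((∑ k, (Q j k / √D) * b k) + ∑ i, (-σ * rinv X j i) * e i) * x0 j + σ * e0) ^ 2 + (-σbar) ^ 2) = σbar ^ 2 + ((∑ j, u j * x0 j) + σ * e0) ^ 2 := by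
            intro e0; simp only [hu]; ring
          simp_rw [this, mom_scalar _ _ _ (sq_nonneg σbar)]
          congr 1
          simp
          ring
        simp_rw [s3]
        rw [mom_vec D 1 _ (by positivity) (fun _ => 0) (fun _ => u)]
        simp [hu]
      simp_rw [s2]
      rw [mom_vec n D _ (by positivity) (fun j => ∑ k, (Q j k / √D) * b k)
        (fun j i => -σ * rinv X j i)]
      congr 1
      rw [Finset.sum_add_distrib]
      simp only [mul_pow, neg_sq, zero_add, ← Finset.mul_sum]
      rw [Finset.sum_comm (f := fun j i => rinv X j i ^ 2)]
      ring
    simp_rw [s1]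
    rw [mom_vec D D _ (by positivity) (fun _ => 0) (fun j k => Q j k / √D)]
    congr 1
    simp only [div_pow, Real.sq_sqrt hDpos.le, ← Finset.sum_div, Finset.sum_add_distrib]
    rw [sum_resid_sq X hdet.isUnit]
    simp
    ring
  rw [lintegral_congr_ae hX, expect_trace n D hnD _ _ _ (sq_nonneg σ), ENNReal.toReal_ofReal]
  · field_simp
    ring
  · have : 0 ≤ ((D:ℝ) - n) / D := div_nonneg (by linarith) hDpos.le
    positivity
  · have : 0 ≤ ((D:ℝ) - n) / D := div_nonneg (by linarith) hDpos.le
    positivity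
end

section
/- Let n + 1 < p, let Xₚ ∈ ℝ^{n×p} be a random matrix with i.i.d. N(0,1) entries, let c > 0, let η ∼ N(0, c·Iₙ) be independent of Xₚ, and let x₀ ∈ ℝᵖ be a fixed vector. Then E[ (x₀ᵀ Xₚ† η)² ] = (n/p)·( c/(p − n − 1) )·‖x₀‖², where † denotes the Moore–Penrose pseudoinverse. (This follows since E[(x₀ᵀXₚ†η)²] = c·x₀ᵀ E[(XₚᵀXₚ)†] x₀ and the generalized inverse Wishart matrix (XₚᵀXₚ)† has expectation (n/p)·(1/(p − n − 1))·Iₚ.) -/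
open MeasureTheory ProbabilityTheory Matrix Filter Topology
open scoped NNReal ENNReal

lemma aux_lap1 (t : ℝ) (ht : 0 ≤ t) :
    ∫⁻ x, ENNReal.ofReal (Real.exp (-t * x ^ 2)) ∂(gaussianReal 0 1)
      = ENNReal.ofReal ((1 + 2 * t) ^ (-(1/2) : ℝ)) := by
  rw [← ofReal_integral_eq_lintegral_ofReal]
  · congr 1
    rw [integral_gaussianReal_eq_integral_smul (by norm_num)]
    have : ∀ x : ℝ, gaussianPDFReal 0 1 x • Real.exp (-t * x ^ 2)
        = (√(2 * Real.pi))⁻¹ * Real.exp (-(t + 1/2) * x ^ 2) := by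
      intro x
      simp only [gaussianPDFReal, smul_eq_mul, NNReal.coe_one, mul_one, sub_zero]
      rw [mul_assoc, ← Real.exp_add]
      congr 2
      ring
    simp_rw [this]
    rw [integral_const_mul, integral_gaussian, Real.rpow_neg (by positivity), ← Real.sqrt_eq_rpow,
      ← Real.sqrt_inv, ← Real.sqrt_inv, ← Real.sqrt_mul (by positivity)]
    congr 1
    have := Real.pi_pos
    field_simp
    ring
  · apply Integrable.mono' (g := fun _ => (1:ℝ)) (integrable_const _)
    · fun_prop
    · refine Filter.Eventually.of_forall fun x => ?_
      rw [Real.norm_eq_abs, abs_of_pos (Real.exp_pos _), Real.exp_le_one_iff]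
      nlinarith [sq_nonneg x, mul_nonneg ht (sq_nonneg x)]
  · exact Filter.Eventually.of_forall fun x => (Real.exp_pos _).le

lemma aux_lap2 {p : ℕ} (s : Finset (Fin p)) (t : ℝ) (ht : 0 ≤ t) :
    ∫⁻ y, ENNReal.ofReal (Real.exp (-t * ∑ i ∈ s, y i ^ 2)) ∂(stdGaussianVec p)
      = ENNReal.ofReal ((1 + 2 * t) ^ (-(s.card / 2 : ℝ))) := by
  have h1 : ∀ y : Fin p → ℝ, ENNReal.ofReal (Real.exp (-t * ∑ i ∈ s, y i ^ 2))
      = ∏ i ∈ s, ENNReal.ofReal (Real.exp (-t * y i ^ 2)) := by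
    intro y
    rw [Finset.mul_sum, Real.exp_sum, ENNReal.ofReal_prod_of_nonneg]
    exact fun i _ => (Real.exp_pos _).le
  simp_rw [h1]
  unfold stdGaussianVec
  have hm : Measurable (fun x : ℝ => ENNReal.ofReal (Real.exp (-t * x ^ 2))) := by fun_prop
  have hind := iIndepFun_pi (μ := fun _ : Fin p => gaussianReal 0 1)
    (X := fun _ x => ENNReal.ofReal (Real.exp (-t * x ^ 2))) (fun i => hm.aemeasurable)
  rw [lintegral_prod_eq_prod_lintegral_of_indepFun s
    (fun i (y : Fin p → ℝ) => ENNReal.ofReal (Real.exp (-t * y i ^ 2))) hind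
    (fun i => by fun_prop)]
  have h2 : ∀ i : Fin p, ∫⁻ (y : Fin p → ℝ), ENNReal.ofReal (Real.exp (-t * y i ^ 2))
      ∂(Measure.pi fun _ => gaussianReal 0 1) = ENNReal.ofReal ((1 + 2 * t) ^ (-(1/2) : ℝ)) := by
    intro i
    rw [← aux_lap1 t ht, ← (measurePreserving_eval (fun _ : Fin p => gaussianReal 0 1) i).lintegral_comp hm]
  simp_rw [h2]
  rw [Finset.prod_const, ← ENNReal.ofReal_pow (by positivity), ← Real.rpow_natCast, ← Real.rpow_mul (by positivity)]
  congr 2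
  ring

lemma aux_int1 (S : ℝ) (hS : 0 ≤ S) :
    ∫⁻ t in Set.Ioi (0:ℝ), ENNReal.ofReal (Real.exp (-t * S)) = (ENNReal.ofReal S)⁻¹ := by
  rcases hS.eq_or_lt with rfl | h
  · simp
  · rw [← ofReal_integral_eq_lintegral_ofReal]
    · have : ∀ t : ℝ, Real.exp (-t * S) = Real.exp ((-S) * t) := fun t => by ring_nf
      simp_rw [this]
      rw [integral_exp_mul_Ioi (by linarith), ENNReal.ofReal_inv_of_pos h |>.symm]
      simp [div_eq_mul_inv, inv_neg]
    · have : ∀ t : ℝ, Real.exp (-t * S) = Real.exp ((-S) * t) := fun t => by ring_nf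
      simp_rw [this]
      exact integrableOn_exp_mul_Ioi (by linarith) 0
    · exact Filter.Eventually.of_forall fun x => (Real.exp_pos _).le

lemma aux_int2 (d : ℝ) (hd : 2 < d) :
    ∫⁻ t in Set.Ioi (0:ℝ), ENNReal.ofReal ((1 + 2 * t) ^ (-(d / 2))) = ENNReal.ofReal (1 / (d - 2)) := by
  have hder : ∀ t ∈ Set.Ici (0:ℝ), HasDerivAt (fun t : ℝ => -(1 + 2 * t) ^ (-(d/2) + 1) / (d - 2))
      ((1 + 2 * t) ^ (-(d / 2))) t := by
    intro t ht
    have ht : 0 ≤ t := ht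
    have h1 : HasDerivAt (fun t : ℝ => 1 + 2 * t) 2 t := by
      simpa using ((hasDerivAt_id t).const_mul 2).const_add 1
    have h2 := ((h1.rpow_const (p := -(d/2) + 1) (Or.inl (by positivity))).neg).div_const (d - 2)
    refine h2.congr_deriv ?_
    have : d - 2 ≠ 0 := by linarith
    rw [add_sub_cancel_right]
    field_simp
    ring
  have hpos : ∀ t ∈ Set.Ioi (0:ℝ), 0 ≤ (1 + 2 * t) ^ (-(d / 2)) := by
    intro t ht
    have ht : 0 < t := ht
    positivity
  have hlim : Tendsto (fun t : ℝ => -(1 + 2 * t) ^ (-(d/2) + 1) / (d - 2)) atTop (𝓝 0) := by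
    have h1 : Tendsto (fun t : ℝ => 1 + 2 * t) atTop atTop :=
      tendsto_atTop_add_const_left _ _ (tendsto_id.const_mul_atTop (by norm_num))
    have h2 := (tendsto_rpow_neg_atTop (y := d/2 - 1) (by linarith)).comp h1
    have h3 := (h2.neg).div_const (d - 2)
    simp only [neg_zero, zero_div] at h3
    convert h3 using 4
    simp only [Function.comp]
    ring_nf
  rw [← ofReal_integral_eq_lintegral_ofReal]
  · rw [integral_Ioi_of_hasDerivAt_of_nonneg' hder hpos hlim]
    congr 1
    simp
    ring
  · exact integrableOn_Ioi_deriv_of_nonneg' hder hpos hlim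
  · exact (ae_restrict_iff' measurableSet_Ioi).2 (Filter.Eventually.of_forall hpos)

instance (k : ℕ) : IsProbabilityMeasure (stdGaussianVec k) := by
  unfold stdGaussianVec; infer_instance

instance (k l : ℕ) : IsProbabilityMeasure (stdGaussianMatrix k l) := by
  unfold stdGaussianMatrix; infer_instance

lemma aux_chi_s16 {p : ℕ} (s : Finset (Fin p)) (hs : 2 < s.card) :
    ∫⁻ y, (ENNReal.ofReal (∑ i ∈ s, y i ^ 2))⁻¹ ∂(stdGaussianVec p)
      = ENNReal.ofReal (1 / ((s.card : ℝ) - 2)) := by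
  have h1 : ∀ y : Fin p → ℝ, (ENNReal.ofReal (∑ i ∈ s, y i ^ 2))⁻¹
      = ∫⁻ t in Set.Ioi (0:ℝ), ENNReal.ofReal (Real.exp (-t * ∑ i ∈ s, y i ^ 2)) := fun y =>
    (aux_int1 _ (Finset.sum_nonneg fun i _ => sq_nonneg _)).symm
  simp_rw [h1]
  rw [lintegral_lintegral_swap, ← aux_int2 _ (by exact_mod_cast hs)]
  · refine setLIntegral_congr_fun measurableSet_Ioi fun t ht => ?_
    exact aux_lap2 s t (le_of_lt ht)
  · apply Measurable.aemeasurable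
    unfold Function.uncurry
    fun_prop

lemma aux_rot {p : ℕ} (b : OrthonormalBasis (Fin p) ℝ (EuclideanSpace ℝ (Fin p))) :
    MeasurePreserving (fun (x : Fin p → ℝ) (i : Fin p) => ∑ j, b i j * x j)
      (stdGaussianVec p) (stdGaussianVec p) := by
  refine ⟨by fun_prop, ?_⟩
  have e : (fun (x : Fin p → ℝ) (i : Fin p) => ∑ j, b i j * x j)
      = (WithLp.ofLp : EuclideanSpace ℝ (Fin p) → (Fin p → ℝ)) ∘ b.repr ∘ (WithLp.toLp 2) := by
    ext x i
    simp [b.repr_apply_apply, PiLp.inner_apply, mul_comm]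
  have h := map_pi_eq_stdGaussian (ι := Fin p)
  rw [e, ← Measure.map_map, ← Measure.map_map]
  · unfold stdGaussianVec
    rw [h, stdGaussian_map, ← h, Measure.map_map]
    · exact Measure.map_id
    all_goals fun_prop
  all_goals fun_prop

lemma aux_basis {p m : ℕ} (v : Fin m → Fin p → ℝ) (hv : LinearIndependent ℝ v) :
    ∃ (b : OrthonormalBasis (Fin p) ℝ (EuclideanSpace ℝ (Fin p))) (s : Finset (Fin p)),
      s.card + m = p ∧ (∀ i ∈ s, ∀ k, ∑ j, b i j * v k j = 0) ∧
      ∀ x : Fin p → ℝ, (x - ∑ i ∈ s, (∑ j, b i j * x j) • (b i).ofLp) ∈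
        Submodule.span ℝ (Set.range v) := by
  let L := (WithLp.linearEquiv 2 ℝ (Fin p → ℝ)).symm
  let W : Submodule ℝ (EuclideanSpace ℝ (Fin p)) := (Submodule.span ℝ (Set.range v)).map L.toLinearMap
  have hW : Module.finrank ℝ W = m := by
    rw [show Module.finrank ℝ W = _ from LinearEquiv.finrank_map_eq L _, finrank_span_eq_card hv, Fintype.card_fin]
  have hW2 := W.finrank_add_finrank_orthogonal
  rw [hW, finrank_euclideanSpace_fin] at hW2
  set d := Module.finrank ℝ Wᗮ with hd
  let e := stdOrthonormalBasis ℝ Wᗮ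
  have hdp : d ≤ p := by omega
  let ι : Fin d ↪ Fin p := Fin.castLEEmb hdp
  let f : Fin p → EuclideanSpace ℝ (Fin p) := fun i =>
    if h : i.1 < d then (e ⟨i.1, h⟩ : EuclideanSpace ℝ (Fin p)) else 0
  have hf : ∀ k, f (ι k) = e k := by
    intro k
    simp [f, ι]
  let s : Finset (Fin p) := Finset.univ.map ι
  have hs : s.card = d := by simp [s]
  have horth : Orthonormal ℝ ((s : Set (Fin p)).domRestrict f) := by
    have he : Orthonormal ℝ (fun k => (e k : EuclideanSpace ℝ (Fin p))) :=
      e.orthonormal.comp_linearIsometry Wᗮ.subtypeₗᵢ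
    rw [orthonormal_iff_ite] at he ⊢
    rintro ⟨i, hi⟩ ⟨j, hj⟩
    simp only [s, Finset.coe_map, Set.mem_image, Finset.mem_coe, Finset.mem_univ, true_and] at hi hj
    obtain ⟨i, rfl⟩ := hi
    obtain ⟨j, rfl⟩ := hj
    simp only [Set.domRestrict_apply, hf, he, Subtype.mk.injEq, ι.injective.eq_iff]
  obtain ⟨b, hb⟩ := horth.exists_orthonormalBasis_extension_of_card_eq (by simp)
  have hbe : ∀ k, b (ι k) = e k := fun k => by rw [hb _ (by simp [s]), hf]
  have hin : ∀ (i : Fin p) (x : Fin p → ℝ), ∑ j, b i j * x j = inner ℝ (b i) (WithLp.toLp 2 x) := by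
    intro i x
    simp [PiLp.inner_apply, mul_comm]
  refine ⟨b, s, by omega, ?_, ?_⟩
  · intro i hi k
    simp only [s, Finset.mem_map, Finset.mem_univ, true_and] at hi
    obtain ⟨i, rfl⟩ := hi
    rw [hin, hbe]
    have h1 : WithLp.toLp 2 (v k) ∈ W := Submodule.mem_map.2 ⟨v k, Submodule.subset_span ⟨k, rfl⟩, rfl⟩
    exact Submodule.inner_left_of_mem_orthogonal h1 (e i).2
  · intro x
    have h2 : ∀ i ∉ s, b i ∈ W := by
      intro i hi
      rw [← Submodule.orthogonal_orthogonal W, Submodule.mem_orthogonal]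
      intro y hy
      have h3 := e.sum_repr' ⟨y, hy⟩
      have h4 := congrArg (Subtype.val) h3
      simp only [Submodule.coe_sum, Submodule.coe_smul] at h4
      rw [← h4, sum_inner]
      refine Finset.sum_eq_zero fun k _ => ?_
      rw [inner_smul_left, ← hbe, b.inner_eq_ite, if_neg, mul_zero]
      rintro rfl
      exact hi (by simp [s])
    have h5 : WithLp.toLp 2 (x - ∑ i ∈ s, (∑ j, b i j * x j) • (b i).ofLp) ∈ W := by
      have h6 : WithLp.toLp 2 (x - ∑ i ∈ s, (∑ j, b i j * x j) • (b i).ofLp)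
          = ∑ i ∈ sᶜ, (∑ j, b i j * x j) • (b i) := by
        have h7 := b.sum_repr' (WithLp.toLp 2 x)
        simp_rw [← hin] at h7
        rw [← Finset.sum_add_sum_compl s] at h7
        rw [WithLp.toLp_sub, WithLp.toLp_sum, ← h7]
        simp
      rw [h6]
      exact Submodule.sum_mem _ fun i hi => W.smul_mem _ (h2 i (by simpa using hi))
    obtain ⟨z, hz, hz2⟩ := Submodule.mem_map.1 h5
    have : z = _ := WithLp.toLp_injective 2 hz2
    rwa [← this]

lemma aux_det {n p : ℕ} (A : Matrix (Fin n) (Fin p) ℝ) (hA : LinearIndependent ℝ A.row) :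
    IsUnit (A * Aᵀ).det := by
  rw [← Matrix.isUnit_iff_isUnit_det]
  have := Matrix.PosDef.conjTranspose_mul_mul_same (A := (1 : Matrix (Fin p) (Fin p) ℝ)) (B := Aᵀ)
    Matrix.PosDef.one (Matrix.mulVec_injective_iff.2 hA)
  simpa using this.isUnit

/-- key algebraic fact -/
lemma aux_alg {p m : ℕ} (v : Fin m → Fin p → ℝ) (hv : LinearIndependent ℝ v) (i : Fin (m+1))
    (b : Fin p → Fin p → ℝ) (hb : ∀ i i', ∑ j, b i j * b i' j = if i = i' then 1 else 0) (s : Finset (Fin p))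
    (h1 : ∀ i ∈ s, ∀ k, ∑ j, b i j * v k j = 0)
    (x : Fin p → ℝ)
    (h2 : (x - ∑ i ∈ s, (∑ j, b i j * x j) • b i) ∈ Submodule.span ℝ (Set.range v))
    (hr : ∑ i ∈ s, (∑ j, b i j * x j) ^ 2 ≠ 0) :
    LinearIndependent ℝ (Fin.insertNth (α := fun _ => Fin p → ℝ) i x v) ∧
    ((Matrix.of (Fin.insertNth (α := fun _ => Fin p → ℝ) i x v) *
      (Matrix.of (Fin.insertNth (α := fun _ => Fin p → ℝ) i x v))ᵀ)⁻¹ i i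
      = (∑ i ∈ s, (∑ j, b i j * x j) ^ 2)⁻¹) := by
  set r := ∑ i ∈ s, (∑ j, b i j * x j) ^ 2 with hrdef
  set u : Fin p → ℝ := ∑ i ∈ s, (∑ j, b i j * x j) • b i with hu
  set a : Fin (m+1) → Fin p → ℝ := Fin.insertNth (α := fun _ => Fin p → ℝ) i x v with ha
  have hud : ∀ y : Fin p → ℝ, y ⬝ᵥ u = ∑ i ∈ s, (∑ j, b i j * x j) * (∑ j, b i j * y j) := by
    intro y
    rw [hu, dotProduct_sum]
    refine Finset.sum_congr rfl fun k _ => ?_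
    rw [dotProduct_smul, smul_eq_mul, dotProduct]
    simp_rw [mul_comm (y _)]
  have hux : x ⬝ᵥ u = r := by
    rw [hud, hrdef]; simp_rw [sq]
  have huv : ∀ k, v k ⬝ᵥ u = 0 := by
    intro k
    rw [hud]
    exact Finset.sum_eq_zero fun i hi => by rw [h1 i hi k, mul_zero]
  have hai : a i = x := by simp [ha]
  have hak : ∀ k, a (i.succAbove k) = v k := by intro k; simp [ha]
  have hLI : LinearIndependent ℝ a := by
    rw [Fintype.linearIndependent_iff]
    intro g hg
    rw [Fin.sum_univ_succAbove _ i] at hg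
    simp_rw [hai, hak] at hg
    have h3 := congrArg (· ⬝ᵥ u) hg
    simp only [add_dotProduct, smul_dotProduct, sum_dotProduct, huv, hux, zero_dotProduct, mul_zero,
      Finset.sum_const_zero, add_zero, smul_eq_mul] at h3
    have hgi : g i = 0 := (mul_eq_zero.1 h3).resolve_right hr
    rw [hgi, zero_smul, zero_add] at hg
    have h4 := Fintype.linearIndependent_iff.1 hv _ hg
    intro k
    rcases Fin.eq_self_or_eq_succAbove i k with rfl | ⟨k, rfl⟩
    · exact hgi
    · exact h4 k
  refine ⟨hLI, ?_⟩
  obtain ⟨q, hq⟩ := (Submodule.mem_span_range_iff_exists_fun ℝ).1 h2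
  let w : Fin (m+1) → ℝ := Fin.insertNth (α := fun _ => ℝ) i 1 (fun k => - q k)
  have hw : (Matrix.of a)ᵀ *ᵥ w = u := by
    rw [Matrix.mulVec_eq_sum, Fin.sum_univ_succAbove _ i]
    have : ∀ k, (Matrix.of a)ᵀᵀ k = a k := fun k => rfl
    simp only [this, hai, hak, w, Fin.insertNth_apply_same, Fin.insertNth_apply_succAbove]
    simp only [op_smul_eq_smul, one_smul, neg_smul, Finset.sum_neg_distrib, hq]
    abel
  have hGw : (Matrix.of a * (Matrix.of a)ᵀ) *ᵥ w = Pi.single i r := by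
    rw [← Matrix.mulVec_mulVec, hw]
    ext k
    change a k ⬝ᵥ u = _
    rcases Fin.eq_self_or_eq_succAbove i k with rfl | ⟨k, rfl⟩
    · rw [hai, hux]; simp
    · rw [hak, huv]; simp
  have hdet := aux_det (Matrix.of a) hLI
  have h5 := congrArg ((Matrix.of a * (Matrix.of a)ᵀ)⁻¹ *ᵥ ·) hGw
  simp only [Matrix.mulVec_mulVec, Matrix.nonsing_inv_mul _ hdet, Matrix.one_mulVec] at h5
  have h6 := congrFun h5 i
  simp [w] at h6
  field_simp
  linarith

lemma aux_step {p m : ℕ} (hm : m + 2 < p) (v : Fin m → Fin p → ℝ) (hv : LinearIndependent ℝ v)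
    (i : Fin (m+1)) :
    (∀ᵐ x ∂(stdGaussianVec p), LinearIndependent ℝ (Fin.insertNth (α := fun _ => Fin p → ℝ) i x v)) ∧
    ∫⁻ x, ENNReal.ofReal ((Matrix.of (Fin.insertNth (α := fun _ => Fin p → ℝ) i x v) *
      (Matrix.of (Fin.insertNth (α := fun _ => Fin p → ℝ) i x v))ᵀ)⁻¹ i i) ∂(stdGaussianVec p)
      = ENNReal.ofReal (1 / ((p : ℝ) - m - 2)) := by
  obtain ⟨b, s, hs, h1, h2⟩ := aux_basis v hv
  have hchi := aux_chi_s16 s (by omega)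
  have hmeas : Measurable fun y : Fin p → ℝ => (ENNReal.ofReal (∑ i ∈ s, y i ^ 2))⁻¹ := by fun_prop
  rw [← (aux_rot b).lintegral_comp hmeas] at hchi
  have hb : ∀ i i', ∑ j, b i j * b i' j = if i = i' then (1:ℝ) else 0 := by
    intro i i'
    have := b.inner_eq_ite i i'
    rw [← this, PiLp.inner_apply]
    simp [mul_comm]
  have hae : ∀ᵐ x ∂(stdGaussianVec p), ∑ i ∈ s, (∑ j, b i j * x j) ^ 2 ≠ 0 := by
    have := ae_lt_top (hmeas.comp (aux_rot b).measurable) (by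
      simp only [Function.comp_def]; rw [hchi]; exact ENNReal.ofReal_ne_top)
    filter_upwards [this] with x hx h0
    simp [h0] at hx
  have key := fun x hx => aux_alg v hv i (fun i => (b i).ofLp) hb s h1 x (h2 x) hx
  refine ⟨hae.mono fun x hx => (key x hx).1, ?_⟩
  have : (p : ℝ) - m - 2 = s.card - 2 := by
    have : ((s.card + m : ℕ) : ℝ) = p := by rw [hs]
    push_cast at this
    linarith
  rw [this, ← hchi]
  refine lintegral_congr_ae (hae.mono fun x hx => ?_)
  simp only
  rw [(key x hx).2, ENNReal.ofReal_inv_of_pos]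
  exact lt_of_le_of_ne (Finset.sum_nonneg fun i _ => sq_nonneg _) hx.symm

lemma aux_ae_li {p : ℕ} (n : ℕ) (hn : n + 1 < p) :
    ∀ᵐ A ∂(stdGaussianMatrix n p), LinearIndependent ℝ A := by
  induction n with
  | zero => exact Filter.Eventually.of_forall fun A => linearIndependent_empty_type
  | succ m ih =>
    have ih := ih (by omega)
    have hmp := (measurePreserving_piFinSuccAbove (fun _ : Fin (m+1) => stdGaussianVec p) 0).symm
    have hS : MeasurableSet {f : Fin (m+1) → Fin p → ℝ | LinearIndependent ℝ f} :=
      isOpen_setOfPred_linearIndependent.measurableSet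
    unfold stdGaussianMatrix
    rw [← hmp.map_eq, ae_map_iff hmp.measurable.aemeasurable hS]
    have hS2 := hmp.measurable hS
    refine (Measure.ae_prod_iff_ae_ae hS2).2 ?_
    refine (Measure.ae_ae_comm (p := fun x y => LinearIndependent ℝ
      ((MeasurableEquiv.piFinSuccAbove (fun _ : Fin (m+1) => Fin p → ℝ) 0).symm (x, y))) hS2).2 ?_
    filter_upwards [ih] with v hv
    exact (aux_step (by omega) v hv 0).1

lemma aux_meas {n p : ℕ} (i j : Fin n) : Measurable fun A : Fin n → Fin p → ℝ =>
    (Matrix.of A * (Matrix.of A)ᵀ)⁻¹ i j := by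
  have hc : Continuous fun A : Fin n → Fin p → ℝ => Matrix.of A := continuous_id
  have hG : Continuous fun A : Fin n → Fin p → ℝ => (Matrix.of A * (Matrix.of A)ᵀ) :=
    hc.matrix_mul hc.matrix_transpose
  simp_rw [Matrix.inv_def, Ring.inverse_eq_inv']
  have h1 := hG.matrix_det.measurable
  have h2 := hG.matrix_adjugate
  exact h1.inv.mul (h2.matrix_elem i j).measurable

lemma aux_diag {p m : ℕ} (hm : m + 2 < p) (i : Fin (m+1)) :
    ∫⁻ A, ENNReal.ofReal ((Matrix.of A * (Matrix.of A)ᵀ)⁻¹ i i) ∂(stdGaussianMatrix (m+1) p)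
      = ENNReal.ofReal (1 / ((p : ℝ) - m - 2)) := by
  have hmp := (measurePreserving_piFinSuccAbove (fun _ : Fin (m+1) => stdGaussianVec p) i).symm
  have hF : Measurable fun A : Fin (m+1) → Fin p → ℝ =>
      ENNReal.ofReal ((Matrix.of A * (Matrix.of A)ᵀ)⁻¹ i i) := by
    exact (aux_meas (n := m+1) (p := p) i i).ennreal_ofReal
  unfold stdGaussianMatrix
  rw [← hmp.lintegral_comp hF]
  refine (lintegral_prod_symm _ (hF.comp hmp.measurable).aemeasurable).trans ?_
  have : ∀ᵐ v ∂(stdGaussianMatrix m p), ∫⁻ x, ENNReal.ofReal ((Matrix.of (Fin.insertNth (α := fun _ => Fin p → ℝ) i x v) *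
      (Matrix.of (Fin.insertNth (α := fun _ => Fin p → ℝ) i x v))ᵀ)⁻¹ i i) ∂(stdGaussianVec p)
      = ENNReal.ofReal (1 / ((p : ℝ) - m - 2)) :=
    (aux_ae_li m (by omega)).mono fun v hv => (aux_step hm v hv i).2
  refine (lintegral_congr_ae this).trans ?_
  simp

/-- the quadratic form `‖(A Aᵀ)⁻¹ A x‖²` -/
noncomputable def auxG {n p : ℕ} (A : Fin n → Fin p → ℝ) (x : Fin p → ℝ) : ℝ :=
  ∑ i, (((Matrix.of A * (Matrix.of A)ᵀ)⁻¹ * Matrix.of A) *ᵥ x) i ^ 2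

lemma auxM_meas {n p : ℕ} (x : Fin p → ℝ) (i : Fin n) : Measurable fun A : Fin n → Fin p → ℝ =>
    (((Matrix.of A * (Matrix.of A)ᵀ)⁻¹ * Matrix.of A) *ᵥ x) i := by
  simp only [Matrix.mulVec, dotProduct, Matrix.mul_apply (M := (_ : Matrix (Fin n) (Fin n) ℝ)⁻¹),
    Matrix.of_apply]
  refine Finset.measurable_sum _ fun j _ => Measurable.mul_const (Finset.measurable_sum _ fun k _ => ?_) _
  refine (aux_meas i k).mul ?_
  fun_prop

lemma auxG_meas {n p : ℕ} (x : Fin p → ℝ) : Measurable fun A : Fin n → Fin p → ℝ => auxG A x := by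
  unfold auxG
  exact Finset.measurable_sum _ fun i _ => (auxM_meas x i).pow_const 2

lemma auxG_nonneg {n p : ℕ} (A : Fin n → Fin p → ℝ) (x : Fin p → ℝ) : 0 ≤ auxG A x :=
  Finset.sum_nonneg fun i _ => sq_nonneg _

lemma auxG_rot {n p : ℕ} (b : OrthonormalBasis (Fin p) ℝ (EuclideanSpace ℝ (Fin p))) (k : Fin p) :
    ∫⁻ A, ENNReal.ofReal (auxG A (b k).ofLp) ∂(stdGaussianMatrix n p)
      = ∫⁻ A, ENNReal.ofReal (auxG A (Pi.single k 1)) ∂(stdGaussianMatrix n p) := by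
  have hmp := measurePreserving_pi (fun _ : Fin n => stdGaussianVec p) (fun _ => stdGaussianVec p)
    (fun _ => aux_rot b)
  unfold stdGaussianMatrix
  conv_rhs => rw [← hmp.lintegral_comp (auxG_meas _).ennreal_ofReal]
  refine lintegral_congr fun A => ?_
  congr 1
  let B : Matrix (Fin p) (Fin p) ℝ := Matrix.of fun i j => b i j
  have hB : B * Bᵀ = 1 := by
    ext i j
    rw [Matrix.mul_apply, Matrix.one_apply, ← b.inner_eq_ite i j, PiLp.inner_apply]
    simp [B, mul_comm]
  have hB2 : Bᵀ * B = 1 := mul_eq_one_comm.1 hB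
  have hA : Matrix.of (fun (a : Fin n) i => ∑ j, (b i).ofLp j * A a j) = Matrix.of A * Bᵀ := by
    ext a i
    simp [Matrix.mul_apply, B, mul_comm]
  have hk : Bᵀ *ᵥ (Pi.single k 1) = (b k).ofLp := by
    ext j
    simp [B]
  unfold auxG
  rw [hA, Matrix.transpose_mul, Matrix.transpose_transpose, Matrix.mul_assoc (Matrix.of A),
    ← Matrix.mul_assoc Bᵀ, hB2, Matrix.one_mul, ← Matrix.mul_assoc, ← Matrix.mulVec_mulVec _ _ Bᵀ, hk]

lemma auxG_sum {n p : ℕ} (A : Fin n → Fin p → ℝ) (hA : LinearIndependent ℝ A) :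
    (∑ k, auxG A (Pi.single k 1) = ∑ i, (Matrix.of A * (Matrix.of A)ᵀ)⁻¹ i i)
     ∧ ∀ i, 0 ≤ (Matrix.of A * (Matrix.of A)ᵀ)⁻¹ i i := by
  have hdet := aux_det (Matrix.of A) hA
  set G := Matrix.of A * (Matrix.of A)ᵀ with hG
  have hGt : G⁻¹ᵀ = G⁻¹ := by
    rw [Matrix.transpose_nonsing_inv, hG, Matrix.transpose_mul, Matrix.transpose_transpose]
  have h1 : (G⁻¹ * Matrix.of A) * (G⁻¹ * Matrix.of A)ᵀ = G⁻¹ := by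
    rw [Matrix.transpose_mul, hGt, Matrix.mul_assoc, ← Matrix.mul_assoc (Matrix.of A), ← hG,
      Matrix.mul_nonsing_inv _ hdet, Matrix.mul_one]
  have h2 : ∀ i, G⁻¹ i i = ∑ k, (G⁻¹ * Matrix.of A) i k ^ 2 := by
    intro i
    conv_lhs => rw [← h1, Matrix.mul_apply]
    simp [sq]
  constructor
  · unfold auxG
    rw [Finset.sum_comm]
    refine Finset.sum_congr rfl fun i _ => ?_
    rw [h2]
    simp [← hG]
  · intro i
    rw [h2]
    exact Finset.sum_nonneg fun i _ => sq_nonneg _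

lemma auxG_smul {n p : ℕ} (A : Fin n → Fin p → ℝ) (r : ℝ) (x : Fin p → ℝ) :
    auxG A (r • x) = r ^ 2 * auxG A x := by
  unfold auxG
  rw [Finset.mul_sum]
  simp [Matrix.mulVec_smul, mul_pow]

lemma auxG_unit {n p : ℕ} (hnp : n + 1 < p) (u : EuclideanSpace ℝ (Fin p)) (hu : ‖u‖ = 1) :
    ∫⁻ A, ENNReal.ofReal (auxG A u.ofLp) ∂(stdGaussianMatrix n p)
      = ENNReal.ofReal ((n : ℝ) / p * (1 / ((p : ℝ) - n - 1))) := by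
  have hE : ∀ k, ∫⁻ A, ENNReal.ofReal (auxG A u.ofLp) ∂(stdGaussianMatrix n p)
      = ∫⁻ A, ENNReal.ofReal (auxG A (Pi.single k 1)) ∂(stdGaussianMatrix n p) := by
    intro k
    have : Orthonormal ℝ (({k} : Set (Fin p)).domRestrict fun _ => u) := by
      rw [orthonormal_iff_ite]
      rintro ⟨i, hi⟩ ⟨j, hj⟩
      simp only [Set.mem_singleton_iff] at hi hj
      subst hi hj
      simp [real_inner_self_eq_norm_sq, hu]
    obtain ⟨b, hb⟩ := this.exists_orthonormalBasis_extension_of_card_eq (by simp)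
    rw [← auxG_rot b k, hb k rfl]
  have hsum : ∑ k, ∫⁻ A, ENNReal.ofReal (auxG A (Pi.single k 1)) ∂(stdGaussianMatrix n p)
      = ∑ i : Fin n, ∫⁻ A, ENNReal.ofReal ((Matrix.of A * (Matrix.of A)ᵀ)⁻¹ i i) ∂(stdGaussianMatrix n p) := by
    rw [← lintegral_finsetSum _ fun k _ => (auxG_meas _).ennreal_ofReal,
      ← lintegral_finsetSum _ fun i _ => (aux_meas i i).ennreal_ofReal]
    refine lintegral_congr_ae ((aux_ae_li n hnp).mono fun A hA => ?_)
    simp only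
    rw [← ENNReal.ofReal_sum_of_nonneg fun k _ => auxG_nonneg _ _,
      ← ENNReal.ofReal_sum_of_nonneg fun i _ => (auxG_sum A hA).2 i, (auxG_sum A hA).1]
  have hdiag : ∀ i : Fin n, ∫⁻ A, ENNReal.ofReal ((Matrix.of A * (Matrix.of A)ᵀ)⁻¹ i i) ∂(stdGaussianMatrix n p)
      = ENNReal.ofReal (1 / ((p : ℝ) - n - 1)) := by
    intro i
    obtain _ | m := n
    · exact i.elim0
    · rw [aux_diag (by omega) i]
      push_cast
      congr 2
      ring
  simp_rw [hdiag, ← hE] at hsum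
  simp only [Finset.sum_const, Finset.card_univ, Fintype.card_fin, nsmul_eq_mul] at hsum
  have hp : (p : ℝ≥0∞) ≠ 0 := by
    have : p ≠ 0 := by omega
    exact_mod_cast this
  have hp' : (0:ℝ) < p := by
    have : 0 < p := by omega
    exact_mod_cast this
  rw [← ENNReal.mul_right_inj hp (ENNReal.natCast_ne_top p), hsum, ← ENNReal.ofReal_natCast,
    ← ENNReal.ofReal_natCast, ← ENNReal.ofReal_mul (by positivity), ← ENNReal.ofReal_mul (by positivity)]
  congr 1
  field_simp

lemma auxG_gen {n p : ℕ} (hnp : n + 1 < p) (x : Fin p → ℝ) :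
    ∫⁻ A, ENNReal.ofReal (auxG A x) ∂(stdGaussianMatrix n p)
      = ENNReal.ofReal ((n : ℝ) / p * (1 / ((p : ℝ) - n - 1)) * ∑ j, x j ^ 2) := by
  obtain ⟨u, hu, hx⟩ : ∃ u : EuclideanSpace ℝ (Fin p), ‖u‖ = 1 ∧ x = ‖WithLp.toLp 2 x‖ • u.ofLp := by
    by_cases h : WithLp.toLp 2 x = 0
    · refine ⟨EuclideanSpace.single ⟨0, by omega⟩ 1, by simp, ?_⟩
      rw [h, norm_zero, zero_smul]
      exact (WithLp.toLp_eq_zero 2).1 h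
    · refine ⟨‖WithLp.toLp 2 x‖⁻¹ • WithLp.toLp 2 x, norm_smul_inv_norm h, ?_⟩
      have : ‖WithLp.toLp 2 x‖ ≠ 0 := norm_ne_zero_iff.2 h
      rw [WithLp.ofLp_smul, smul_smul, mul_inv_cancel₀ this, one_smul]
  have hn : ∑ j, x j ^ 2 = ‖WithLp.toLp 2 x‖ ^ 2 := by
    rw [EuclideanSpace.real_norm_sq_eq]
  rw [hn]
  set r := ‖WithLp.toLp 2 x‖
  rw [hx]
  simp_rw [auxG_smul, ENNReal.ofReal_mul (sq_nonneg r)]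
  rw [lintegral_const_mul _ (auxG_meas _).ennreal_ofReal, auxG_unit hnp u hu,
    ← ENNReal.ofReal_mul (sq_nonneg r), mul_comm]

lemma aux_pinv {n p : ℕ} (A : Matrix (Fin n) (Fin p) ℝ) (hA : LinearIndependent ℝ A.row) :
    pinv A = Aᵀ * (A * Aᵀ)⁻¹ := by
  have hdet := aux_det A hA
  have hAN : A * (Aᵀ * (A * Aᵀ)⁻¹) = 1 := by
    rw [← Matrix.mul_assoc, Matrix.mul_nonsing_inv _ hdet]
  have hGt : (A * Aᵀ)⁻¹ᵀ = (A * Aᵀ)⁻¹ := by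
    rw [Matrix.transpose_nonsing_inv, Matrix.transpose_mul, Matrix.transpose_transpose]
  have hex : ∃ B : Matrix (Fin p) (Fin n) ℝ,
      A * B * A = A ∧ B * A * B = B ∧ (A * B)ᵀ = A * B ∧ (B * A)ᵀ = B * A := by
    refine ⟨Aᵀ * (A * Aᵀ)⁻¹, ?_, ?_, ?_, ?_⟩
    · rw [hAN, Matrix.one_mul]
    · rw [Matrix.mul_assoc, hAN, Matrix.mul_one]
    · rw [hAN, Matrix.transpose_one]
    · rw [Matrix.transpose_mul, Matrix.transpose_mul, Matrix.transpose_transpose, hGt, Matrix.mul_assoc]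
  have hB : pinv A = hex.choose := by
    unfold pinv
    rw [dif_pos hex]
  obtain ⟨h1, -, -, h4⟩ := hex.choose_spec
  rw [← hB] at h1 h4
  calc pinv A = pinv A * A * (Aᵀ * (A * Aᵀ)⁻¹) := by rw [Matrix.mul_assoc, hAN, Matrix.mul_one]
    _ = (A * pinv A * A)ᵀ * (A * Aᵀ)⁻¹ := by
      rw [← h4, ← Matrix.mul_assoc, ← Matrix.transpose_mul, ← Matrix.mul_assoc]
    _ = _ := by rw [h1]

lemma aux_noise {n : ℕ} (w : Fin n → ℝ) :
    ∫⁻ g, ENNReal.ofReal ((∑ i, w i * g i) ^ 2) ∂(stdGaussianVec n) = ENNReal.ofReal (∑ i, w i ^ 2) := by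
  unfold stdGaussianVec
  have hL : ∀ i : Fin n, MemLp (fun x : ℝ => w i * x) 2 (gaussianReal 0 1) := fun i =>
    IsGaussian.memLp_two_id.const_mul (w i)
  have hL' : ∀ i : Fin n, MemLp (fun g : Fin n → ℝ => w i * g i) 2 (Measure.pi fun _ => gaussianReal 0 1) :=
    fun i => (hL i).comp_measurePreserving (measurePreserving_eval (fun _ : Fin n => gaussianReal 0 1) i)
  have hsum : MemLp (fun g : Fin n → ℝ => ∑ i, w i * g i) 2 (Measure.pi fun _ => gaussianReal 0 1) :=
    memLp_finsetSum _ fun i _ => hL' i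
  rw [← ofReal_integral_eq_lintegral_ofReal hsum.integrable_sq
    (Filter.Eventually.of_forall fun g => sq_nonneg _)]
  congr 1
  have hv := variance_sum_pi (X := fun i x => w i * x) hL
  have e : (∑ i, fun g : Fin n → ℝ => w i * g i) = fun g : Fin n → ℝ => ∑ i, w i * g i := by
    ext g; simp
  rw [e, variance_of_integral_eq_zero hsum.aestronglyMeasurable.aemeasurable] at hv
  · rw [hv]
    refine Finset.sum_congr rfl fun i _ => ?_
    rw [variance_const_mul]
    simp [variance_fun_id_gaussianReal]
  · rw [integral_finsetSum _ fun i _ => (hL' i).integrable (by norm_num)]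
    refine Finset.sum_eq_zero fun i _ => ?_
    rw [integral_const_mul]
    rw [integral_eval (μ := fun _ : Fin n => gaussianReal 0 1)]
    simp

/-- **Noise term in the variance of the min-norm least squares prediction.**
Let `n + 1 < p`, let `Xₚ` be an `n × p` Gaussian matrix, and `η ∼ N(0, c·Iₙ)`
independent of `Xₚ` (modeled as `η = √c · g` for a standard Gaussian vector `g`).
Then for any fixed `x₀ ∈ ℝᵖ`, `E[(x₀ᵀ Xₚ† η)²] = (n/p)·(c/(p − n − 1))·‖x₀‖²`. -/
theorem expected_sq_noise_term (n p : ℕ) (hnp : n + 1 < p) (c : ℝ) (hc : 0 < c)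
    (x₀ : Fin p → ℝ) :
    ∫ ω : (Fin n → Fin p → ℝ) × (Fin n → ℝ),
        (∑ j, x₀ j * (pinv (Matrix.of ω.1) *ᵥ (fun i => Real.sqrt c * ω.2 i)) j) ^ 2
        ∂((stdGaussianMatrix n p).prod (stdGaussianVec n))
      = ((n : ℝ) / p) * (c / ((p : ℝ) - n - 1)) * ∑ j, x₀ j ^ 2 := by
  have hae : ∀ᵐ ω ∂((stdGaussianMatrix n p).prod (stdGaussianVec n)), LinearIndependent ℝ ω.1 :=
    (Measure.quasiMeasurePreserving_fst).ae (aux_ae_li n hnp)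
  have hcongr : ∀ᵐ ω ∂((stdGaussianMatrix n p).prod (stdGaussianVec n)),
      (∑ j, x₀ j * (pinv (Matrix.of ω.1) *ᵥ (fun i => Real.sqrt c * ω.2 i)) j) ^ 2
      = c * (∑ i, (((Matrix.of ω.1 * (Matrix.of ω.1)ᵀ)⁻¹ * Matrix.of ω.1) *ᵥ x₀) i * ω.2 i) ^ 2 := by
    filter_upwards [hae] with ω hω
    rw [aux_pinv (Matrix.of ω.1) hω]
    set A := Matrix.of ω.1
    have hGt : (A * Aᵀ)⁻¹ᵀ = (A * Aᵀ)⁻¹ := by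
      rw [Matrix.transpose_nonsing_inv, Matrix.transpose_mul, Matrix.transpose_transpose]
    have h1 : (fun i => Real.sqrt c * ω.2 i) = Real.sqrt c • ω.2 := rfl
    change (x₀ ⬝ᵥ _) ^ 2 = c * (_ ⬝ᵥ ω.2) ^ 2
    rw [h1, Matrix.mulVec_smul, dotProduct_smul, smul_eq_mul, mul_pow, Real.sq_sqrt hc.le,
      Matrix.dotProduct_mulVec, ← Matrix.mulVec_transpose, Matrix.transpose_mul, hGt,
      Matrix.transpose_transpose]
  rw [integral_congr_ae hcongr, integral_const_mul]
  have hm : Measurable fun ω : (Fin n → Fin p → ℝ) × (Fin n → ℝ) =>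
      (∑ i, (((Matrix.of ω.1 * (Matrix.of ω.1)ᵀ)⁻¹ * Matrix.of ω.1) *ᵥ x₀) i * ω.2 i) ^ 2 := by
    refine Measurable.pow_const (Finset.measurable_sum _ fun i _ => ?_) 2
    exact ((auxM_meas x₀ i).comp measurable_fst).mul (by fun_prop)
  rw [integral_eq_lintegral_of_nonneg_ae (Filter.Eventually.of_forall fun ω => sq_nonneg _)
    hm.aestronglyMeasurable, lintegral_prod _ hm.ennreal_ofReal.aemeasurable]
  simp_rw [aux_noise]
  have h := auxG_gen hnp x₀
  unfold auxG at h
  have hpn : 0 < (p : ℝ) - n - 1 := by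
    have : ((n + 1 : ℕ) : ℝ) < p := by exact_mod_cast hnp
    push_cast at this
    linarith
  rw [h, ENNReal.toReal_ofReal]
  · ring
  · have : 0 ≤ ∑ j, x₀ j ^ 2 := Finset.sum_nonneg fun i _ => sq_nonneg _
    positivity
end
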